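/- Let n ≥ 1, α ∈ (0,1), k ≥ 1, and let U_1, …, U_{n+1} be exchangeable random vectors with values in ℝ^k. Define m_i := max_{1 ≤ j ≤ k} (U_i)_j for each i, and let q := Q(1−α, {m_1, …, m_n} ∪ {+∞}). Then P[ (U_{n+1})_j ≤ q for all j ∈ {1, …, k} ] ≥ 1−α; that is, U_{n+1} ≼ (q, …, q) with probability at least 1−α, where ≼ denotes the componentwise order on ℝ^k. -/

import Mathlib

open MeasureTheory

/-- The empirical `(1-α)`-quantile of a finite multiset of extended reals. -/
noncomputable def empQuantile (α : ℝ) (S : Multiset EReal) : EReal :=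
  sInf {q : EReal | 1 - α ≤ ((S.filter (fun s => s ≤ q)).card : ℝ) / (S.card : ℝ)}

/-- The number of entries of `x` strictly below the entry at `i`. -/
noncomputable def strictRank {N : ℕ} (x : Fin N → ℝ) (i : Fin N) : ℕ :=
  (Finset.univ.filter fun l => x l < x i).card

lemma strictRank_comp_perm {N : ℕ} (x : Fin N → ℝ) (σ : Equiv.Perm (Fin N)) (i : Fin N) :
    strictRank (fun l => x (σ l)) i = strictRank x (σ i) := by
  unfold strictRank
  refine Finset.card_bij (fun l _ => σ l) ?_ ?_ ?_
  · intro l hl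
    simpa using hl
  · intro a _ b _ h
    exact σ.injective h
  · intro b hb
    exact ⟨σ.symm b, by simpa using hb, by simp⟩

lemma measurable_strictRank {N : ℕ} (i : Fin N) :
    Measurable fun x : Fin N → ℝ => strictRank x i := by
  unfold strictRank
  simp only [Finset.card_filter]
  refine Finset.measurable_sum _ fun l _ => Measurable.ite ?_ measurable_const measurable_const
  exact measurableSet_lt (measurable_pi_apply l) (measurable_pi_apply i)

/-- At least `c` indices have strict rank below `c`, for `c` at most the number of indices. -/
lemma le_card_strictRank_lt {N : ℕ} (x : Fin N → ℝ) {c : ℝ} (hc : c ≤ N) :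
    c ≤ ((Finset.univ.filter fun i => (strictRank x i : ℝ) < c).card : ℝ) := by
  by_cases h : (Finset.univ.filter fun i => c ≤ (strictRank x i : ℝ)).Nonempty
  · obtain ⟨i, hi, hmin⟩ := Finset.exists_min_image _ x h
    have hi' : c ≤ (strictRank x i : ℝ) := by simpa using hi
    refine hi'.trans (Nat.cast_le.mpr (Finset.card_le_card fun l hl => ?_))
    simp only [Finset.mem_filter, Finset.mem_univ, true_and] at hl ⊢
    by_contra! hcl
    exact absurd (hmin l (by simpa using hcl)) (not_le.mpr hl)
  · rw [Finset.not_nonempty_iff_eq_empty, Finset.filter_eq_empty_iff] at h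
    rw [Finset.filter_true_of_mem fun i hi => not_le.mp (h hi)]
    simpa using hc

/-- A real number of small strict rank is bounded by the conformal quantile of the others. -/
lemma le_empQuantile_of_strictRank_lt {n : ℕ} (x : Fin (n + 1) → ℝ) {α : ℝ}
    (h : (strictRank x (Fin.last n) : ℝ) < (1 - α) * (n + 1)) :
    (x (Fin.last n) : EReal) ≤
      empQuantile α ((Finset.univ.val.map fun i : Fin n => (x i.castSucc : EReal)) + {⊤}) := by
  refine le_sInf fun q hq => ?_
  by_contra! hlt
  have hq' : ¬ (⊤ : EReal) ≤ q := fun ht => absurd (hlt.trans_le le_top) (not_lt.mpr ht)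
  have hcard : (Finset.univ.filter fun i : Fin n => (x i.castSucc : EReal) ≤ q).card ≤
      strictRank x (Fin.last n) := by
    refine Finset.card_le_card_of_injOn Fin.castSucc (fun i hi => ?_)
      (Fin.castSucc_injective n).injOn
    have hi' : (x i.castSucc : EReal) ≤ q := by simpa using hi
    simpa using EReal.coe_lt_coe_iff.mp (hi'.trans_lt hlt)
  have hpos : (0 : ℝ) < n + 1 := by positivity
  have hfilter : (((Finset.univ.val.map fun i : Fin n => (x i.castSucc : EReal)) + {⊤}).filter
      (fun s => s ≤ q)).card =
      (Finset.univ.filter fun i : Fin n => (x i.castSucc : EReal) ≤ q).card := by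
    rw [Multiset.filter_add, Multiset.filter_singleton, if_neg hq', Multiset.filter_map,
      Multiset.card_add, Multiset.card_map]
    rfl
  rw [Set.mem_ofPred_eq, hfilter, Multiset.card_add, Multiset.card_map, Multiset.card_singleton,
    Finset.card_val, Finset.card_univ, Fintype.card_fin, Nat.cast_add, Nat.cast_one,
    le_div_iff₀ hpos] at hq
  exact absurd (hq.trans (Nat.cast_le.mpr hcard)) (not_le.mpr h)

/-- Events of equal probability of which at least `c` always occur have probability at least
`c` divided by their number. -/
lemma ofReal_le_card_mul_measure {Ω ι : Type*} [MeasurableSpace Ω] [Fintype ι] (P : Measure Ω)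
    [IsProbabilityMeasure P] (E : ι → Set Ω) (hE : ∀ i, MeasurableSet (E i)) (i₀ : ι)
    (heq : ∀ i, P (E i) = P (E i₀)) (c : ENNReal)
    (hc : ∀ ω, c ≤ ∑ i, (E i).indicator 1 ω) :
    c ≤ Fintype.card ι * P (E i₀) := by
  calc c = ∫⁻ _, c ∂P := by simp
    _ ≤ ∫⁻ ω, ∑ i, (E i).indicator 1 ω ∂P := lintegral_mono hc
    _ = ∑ i, P (E i) := by
      rw [lintegral_finsetSum _ fun i _ => measurable_one.indicator (hE i)]
      simp [hE]
    _ = Fintype.card ι * P (E i₀) := by simp [heq]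

/-- Joint (full-horizon) coverage with a common threshold: for exchangeable random
vectors `U_1, …, U_{n+1}` in `ℝ^k`, with `m_i := max_j (U_i)_j` and
`q := Q(1-α, {m_1,…,m_n} ∪ {+∞})`, the event that every coordinate of `U_{n+1}`
is at most `q` has probability at least `1-α`. -/
theorem stmt_8 {Ω : Type*} [MeasurableSpace Ω] (P : Measure Ω) [IsProbabilityMeasure P]
    (n k : ℕ) (hn : 1 ≤ n) (hk : 1 ≤ k) (α : ℝ) (hα : α ∈ Set.Ioo (0 : ℝ) 1)
    (U : Fin (n + 1) → Ω → (Fin k → ℝ)) (hmeas : ∀ i, Measurable (U i))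
    (hexch : ∀ σ : Equiv.Perm (Fin (n + 1)),
      Measure.map (fun ω => fun i => U (σ i) ω) P = Measure.map (fun ω => fun i => U i ω) P) :
    ENNReal.ofReal (1 - α) ≤
      P {ω | ∀ j : Fin k, (U (Fin.last n) ω j : EReal) ≤
        empQuantile α
          ((Finset.univ.val.map fun i : Fin n =>
            ((Finset.univ.sup' (Finset.univ_nonempty_iff.mpr ⟨⟨0, hk⟩⟩)
              (fun j' : Fin k => U i.castSucc ω j') : ℝ) : EReal)) + {⊤})} := by
  have hne : (Finset.univ : Finset (Fin k)).Nonempty := Finset.univ_nonempty_iff.mpr ⟨⟨0, hk⟩⟩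
  let g : (Fin k → ℝ) → ℝ := fun v => Finset.univ.sup' hne v
  have hg : Measurable g := by
    have := Finset.measurable_sup' hne (f := fun (j : Fin k) (v : Fin k → ℝ) => v j)
      fun j _ => measurable_pi_apply j
    convert this using 1
    ext v
    simp [g, Finset.sup'_apply]
  let x : Ω → Fin (n + 1) → ℝ := fun ω i => g (U i ω)
  let c : ℝ := (1 - α) * (n + 1)
  let E : Fin (n + 1) → Set Ω := fun i => {ω | (strictRank (x ω) i : ℝ) < c}
  let A : Set (Fin (n + 1) → Fin k → ℝ) :=
    {u | (strictRank (fun i => g (u i)) (Fin.last n) : ℝ) < c}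
  have hrank (i : Fin (n + 1)) : MeasurableSet {y : Fin (n + 1) → ℝ | (strictRank y i : ℝ) < c} :=
    (measurable_strictRank i) (MeasurableSet.of_discrete (s := {r : ℕ | (r : ℝ) < c}))
  have hx : Measurable x := measurable_pi_lambda _ fun i => hg.comp (hmeas i)
  have hA : MeasurableSet A :=
    (measurable_pi_lambda (fun (u : Fin (n + 1) → Fin k → ℝ) i => g (u i))
      fun i => hg.comp (measurable_pi_apply i)) (hrank (Fin.last n))
  have hEeq (i : Fin (n + 1)) : P (E i) = P (E (Fin.last n)) := by
    have h := congrArg (fun ν => ν A) (hexch (Equiv.swap i (Fin.last n)))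
    rw [Measure.map_apply (measurable_pi_lambda _ fun i => hmeas _) hA,
      Measure.map_apply (measurable_pi_lambda _ fun i => hmeas _) hA] at h
    refine Eq.trans (congrArg P ?_) h
    ext ω
    have := strictRank_comp_perm (x ω) (Equiv.swap i (Fin.last n)) (Fin.last n)
    rw [Equiv.swap_apply_right] at this
    change (strictRank (x ω) i : ℝ) < c ↔ _
    rw [← this]
    rfl
  have hcount (ω : Ω) : ENNReal.ofReal c ≤ ∑ i, (E i).indicator 1 ω := by
    have hc : c ≤ ((n + 1 : ℕ) : ℝ) := by
      push_cast
      exact mul_le_of_le_one_left (by positivity) (by linarith [hα.1])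
    have hsum : ∑ i, (E i).indicator (1 : Ω → ENNReal) ω =
        ((Finset.univ.filter fun i => (strictRank (x ω) i : ℝ) < c).card : ENNReal) := by
      simp [E, Set.indicator_apply]
    rw [hsum]
    exact ENNReal.ofReal_le_of_le_toReal (by simpa using le_card_strictRank_lt (x ω) hc)
  have hmain := ofReal_le_card_mul_measure P E (fun i => hx (hrank i)) (Fin.last n) hEeq _ hcount
  have hle : ENNReal.ofReal (1 - α) ≤ P (E (Fin.last n)) := by
    rw [Fintype.card_fin, ENNReal.ofReal_mul (by linarith [hα.2]), mul_comm,
      show ((n : ℝ) + 1) = ((n + 1 : ℕ) : ℝ) by push_cast; rfl, ENNReal.ofReal_natCast] at hmain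
    exact (ENNReal.mul_le_mul_iff_right (by simp) (ENNReal.natCast_ne_top _)).mp hmain
  refine hle.trans (measure_mono fun ω hω j => ?_)
  refine le_trans ?_ (le_empQuantile_of_strictRank_lt (x ω) hω)
  exact EReal.coe_le_coe_iff.mpr (Finset.le_sup' (U (Fin.last n) ω) (Finset.mem_univ j))
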